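/- arXiv:2603.16383 — 2 statements merged into one kernel-verified Lean document; each statement's English description precedes it below -/
import Mathlib

section
/- Under assumptions (A) and (A+), for every pair (s,t) with 0 ≤ s ≤ t ≤ T the map x ↦ Φ̄_{s,t}(x) is Fréchet differentiable on X, and its derivative J_{s,t}(x) := D_x Φ̄_{s,t}(x) ∈ L(X;X) is characterized as follows: for every h ∈ X, the function t ↦ J_{s,t}(x) h is the unique mild solution of the variational equation J_{s,t}(x) h = S_{t−s} h + ∫_s^t S_{t−τ} ( Df_τ(Φ̄_{s,τ}(x)) [J_{s,τ}(x) h] + DG_τ(Φ̄_{s,τ}(x))[J_{s,τ}(x) h] ū(τ) ) dτ. -/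
open MeasureTheory Set
open scoped RealInnerProductSpace

noncomputable section

/-- `φ` is a mild solution on `[s,T]` with initial data `(s, x)` for the semigroup `S`. -/
def IsMildSol {X : Type*} [NormedAddCommGroup X] [NormedSpace ℝ X]
    (T : ℝ) (S : ℝ → X →L[ℝ] X) (F : ℝ → X → X) (s : ℝ) (x : X) (φ : ℝ → X) : Prop :=
  ContinuousOn φ (Set.Icc s T) ∧
    ∀ t ∈ Set.Icc s T, φ t = S (t - s) x + ∫ τ in s..t, S (t - τ) (F τ (φ τ))

/-- Carathéodory measurability of superpositions. -/
theorem aux_meas {X Y : Type*} [NormedAddCommGroup X] [NormedAddCommGroup Y]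
    {μ : Measure ℝ} (H : ℝ → X → Y)
    (hm : ∀ x, AEStronglyMeasurable (fun t => H t x) μ)
    (hc : ∀ᵐ t ∂μ, Continuous (H t)) (φ : ℝ → X) (hφ : AEStronglyMeasurable φ μ) :
    AEStronglyMeasurable (fun t => H t (φ t)) μ := by
  have hsm := hφ.stronglyMeasurable_mk
  have key : AEStronglyMeasurable (fun t => H t (hφ.mk φ t)) μ := by
    refine aestronglyMeasurable_of_tendsto_ae Filter.atTop
      (f := fun n t => H t (hsm.approx n t)) ?_ ?_
    · intro n
      set σ := hsm.approx n
      have : Countable (σ.range : Set X) := σ.range.countable_toSet.to_subtype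
      have hU : (⋃ y : (σ.range : Set X), σ ⁻¹' {(y : X)}) = univ := by
        refine eq_univ_of_forall fun t => mem_iUnion.2 ⟨⟨σ t, by simp⟩, rfl⟩
      rw [← Measure.restrict_univ (μ := μ), ← hU, aestronglyMeasurable_iUnion_iff]
      intro y
      refine ((hm y).restrict (s := σ ⁻¹' {(y : X)})).congr ?_
      filter_upwards [ae_restrict_mem (σ.measurableSet_preimage {(y : X)})] with t ht
      have : σ t = y := ht
      rw [this]
    · filter_upwards [hc] with t ht
      exact (ht.tendsto _).comp (hsm.tendsto_approx t)
  refine key.congr ?_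
  filter_upwards [hφ.ae_eq_mk] with t ht
  rw [ht]

theorem aux_SB_meas {X : Type*} [NormedAddCommGroup X] [NormedSpace ℝ X]
    {μ : Measure ℝ} (S : ℝ → X →L[ℝ] X) (hS : ∀ x, Continuous fun σ => S σ x)
    (g : ℝ → X) (hg : AEStronglyMeasurable g μ) (t : ℝ) :
    AEStronglyMeasurable (fun τ => S (t - τ) (g τ)) μ := by
  refine aux_meas (fun τ x => S (t - τ) x) (fun x => ?_) ?_ g hg
  · exact ((hS x).comp (continuous_const.sub continuous_id)).aestronglyMeasurable
  · exact Filter.Eventually.of_forall fun τ => (S (t - τ)).continuous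

theorem aux_int {X : Type*} [NormedAddCommGroup X] [NormedSpace ℝ X]
    {s T C K : ℝ} (S : ℝ → X →L[ℝ] X) (hS : ∀ x, Continuous fun σ => S σ x)
    (hC : ∀ σ, ‖S σ‖ ≤ C)
    (g : ℝ → X) (hg : AEStronglyMeasurable g (volume.restrict (Icc s T)))
    (hK : ∀ᵐ τ ∂(volume.restrict (Icc s T)), ‖g τ‖ ≤ K) (t : ℝ) (ht : t ∈ Icc s T) :
    IntervalIntegrable (fun τ => S (t - τ) (g τ)) volume s t := by
  rw [intervalIntegrable_iff_integrableOn_Icc_of_le ht.1]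
  have h1 : IntegrableOn (fun τ => S (t - τ) (g τ)) (Icc s T) volume := by
    refine Integrable.of_bound (aux_SB_meas S hS g hg t) (C * K) ?_
    filter_upwards [hK] with τ hτ
    exact ((S (t - τ)).le_opNorm _).trans
      (mul_le_mul (hC _) hτ (norm_nonneg _) ((norm_nonneg _).trans (hC 0)))
  exact h1.mono_set (Icc_subset_Icc_right ht.2)

theorem aux_cont {X : Type*} [NormedAddCommGroup X] [NormedSpace ℝ X]
    {s T C K : ℝ} (S : ℝ → X →L[ℝ] X) (hS : ∀ x, Continuous fun σ => S σ x)
    (hC : ∀ σ, ‖S σ‖ ≤ C)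
    (g : ℝ → X) (hg : AEStronglyMeasurable g (volume.restrict (Icc s T)))
    (hK : ∀ᵐ τ ∂(volume.restrict (Icc s T)), ‖g τ‖ ≤ K) :
    ContinuousOn (fun t => ∫ τ in s..t, S (t - τ) (g τ)) (Icc s T) := by
  have hC0 : 0 ≤ C := (norm_nonneg _).trans (hC 0)
  set g' := (Icc s T).indicator g
  have hg' : AEStronglyMeasurable g' volume :=
    (aestronglyMeasurable_indicator_iff measurableSet_Icc).2 hg
  have hK' : ∀ᵐ τ, ‖g' τ‖ ≤ |K| := by
    rw [ae_restrict_iff' measurableSet_Icc] at hK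
    filter_upwards [hK] with τ hτ
    by_cases h : τ ∈ Icc s T
    · simp only [g', indicator_of_mem h]; exact (hτ h).trans (le_abs_self _)
    · simp [g', indicator_of_notMem h]
  have hEq : ∀ t ∈ Icc s T, ∫ τ in s..t, S (t - τ) (g τ) = ∫ τ in s..t, S (t - τ) (g' τ) := by
    intro t ht
    refine intervalIntegral.integral_congr fun τ hτ => ?_
    rw [uIcc_of_le ht.1] at hτ
    have : τ ∈ Icc s T := ⟨hτ.1, hτ.2.trans ht.2⟩
    simp [g', indicator_of_mem this]
  refine ContinuousOn.congr (f := fun t => ∫ τ in s..t, S (t - τ) (g' τ)) ?_ hEq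
  intro t ht
  refine ContinuousAt.continuousWithinAt ?_
  have := intervalIntegral.continuousAt_parametric_primitive_of_dominated (μ := volume)
    (F := fun t τ => S (t - τ) (g' τ)) (fun _ => C * |K|) (s - 1) (T + 1) (a₀ := s) (b₀ := t)
    (x₀ := t) ?_ ?_ ?_ ?_ ?_ ?_ ?_
  · exact ContinuousAt.comp (f := fun t : ℝ => (t, t))
      (g := fun p : ℝ × ℝ => ∫ τ in s..p.2, S (p.1 - τ) (g' τ)) this (by fun_prop)
  · intro t; exact aux_SB_meas S hS g' hg'.restrict t
  · refine Filter.Eventually.of_forall fun t => ae_restrict_of_ae ?_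
    filter_upwards [hK'] with τ hτ
    exact ((S (t - τ)).le_opNorm _).trans (mul_le_mul (hC _) hτ (norm_nonneg _) hC0)
  · exact intervalIntegrable_const
  · refine Filter.Eventually.of_forall fun τ => ?_
    exact ((hS (g' τ)).comp (continuous_id.sub continuous_const)).continuousAt
  · exact ⟨by linarith, by linarith [ht.1, ht.2]⟩
  · exact ⟨by linarith [ht.1], by linarith [ht.2]⟩
  · simp

/-- Integral Gronwall. -/
theorem aux_gronwall {s T a b : ℝ} (hb : 0 ≤ b) (u : ℝ → ℝ) (hu : ContinuousOn u (Icc s T))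
    (h : ∀ t ∈ Icc s T, u t ≤ a + b * ∫ τ in s..t, u τ) :
    ∀ t ∈ Icc s T, u t ≤ a * Real.exp (b * (t - s)) := by
  intro t ht
  have hsT : s ≤ T := ht.1.trans ht.2
  have hder : ∀ x ∈ Icc s T,
      HasDerivWithinAt (fun x => a + b * ∫ τ in s..x, u τ) (b * u x) (Icc s T) x := by
    intro x hx
    have : Fact (x ∈ Icc s T) := ⟨hx⟩
    have hii : IntervalIntegrable u volume s x :=
      (hu.mono (by rw [uIcc_of_le hx.1]; exact Icc_subset_Icc_right hx.2)).intervalIntegrable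
    have h1 : HasDerivWithinAt (fun x => ∫ τ in s..x, u τ) (u x) (Icc s T) x :=
      intervalIntegral.integral_hasDerivWithinAt_right hii
        (hu.stronglyMeasurableAtFilter_nhdsWithin measurableSet_Icc x) (hu x hx)
    exact (h1.const_mul b).const_add a
  have := le_gronwallBound_of_liminf_deriv_right_le (f := fun x => a + b * ∫ τ in s..x, u τ)
    (f' := fun x => b * u x) (δ := a) (K := b) (ε := 0) (a := s) (b := T)
    (fun x hx => (hder x hx).continuousWithinAt)
    (fun x hx r hr => by
      have h2 : HasDerivWithinAt (fun x => a + b * ∫ τ in s..x, u τ) (b * u x) (Ici x) x :=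
        (hder x (Ico_subset_Icc_self hx)).mono_of_mem_nhdsWithin
          (Icc_mem_nhdsGE_of_mem hx)
      have := h2.liminf_right_slope_le hr
      simpa [slope_def_module] using this)
    (by simp) (fun x hx => by
      have := h x (Ico_subset_Icc_self hx)
      simp only [add_zero]; exact mul_le_mul_of_nonneg_left this hb) t ht
  rw [gronwallBound_ε0] at this
  exact (h t ht).trans this

theorem aux_est {X : Type*} [NormedAddCommGroup X] [NormedSpace ℝ X]
    {s T C L a κ : ℝ} (S : ℝ → X →L[ℝ] X)
    (hC : ∀ σ, ‖S σ‖ ≤ C) (hL : 0 ≤ L) (hκ : 0 ≤ κ)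
    (g d c : ℝ → X) (hd : ContinuousOn d (Icc s T))
    (hg : ∀ᵐ τ ∂(volume.restrict (Icc s T)), ‖g τ‖ ≤ L * ‖d τ‖ + κ)
    (hc : ∀ t ∈ Icc s T, ‖c t‖ ≤ a)
    (h : ∀ t ∈ Icc s T, d t = c t + ∫ τ in s..t, S (t - τ) (g τ)) :
    ∀ t ∈ Icc s T, ‖d t‖ ≤ (a + C * κ * (T - s)) * Real.exp (C * L * (T - s)) := by
  have hC0 : 0 ≤ C := (norm_nonneg _).trans (hC 0)
  intro t ht
  have ha : 0 ≤ a := (norm_nonneg _).trans (hc t ht)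
  have hsT : s ≤ T := ht.1.trans ht.2
  have hA : 0 ≤ a + C * κ * (T - s) := by
    have : 0 ≤ T - s := by linarith
    positivity
  have := aux_gronwall (s := s) (T := T) (a := a + C * κ * (T - s)) (b := C * L) (by positivity)
    (fun t => ‖d t‖) hd.norm ?_ t ht
  · refine this.trans (mul_le_mul_of_nonneg_left ?_ hA)
    refine Real.exp_le_exp.2 (mul_le_mul_of_nonneg_left (by linarith [ht.2]) (by positivity))
  · intro t ht
    have hii : IntervalIntegrable (fun τ => ‖d τ‖) volume s t :=
      (hd.norm.mono (by rw [uIcc_of_le ht.1]; exact Icc_subset_Icc_right ht.2)).intervalIntegrable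
    have h1 : ‖∫ τ in s..t, S (t - τ) (g τ)‖ ≤ ∫ τ in s..t, (C * L * ‖d τ‖ + C * κ) := by
      refine intervalIntegral.norm_integral_le_of_norm_le ht.1 ?_
        ((hii.const_mul _).add intervalIntegrable_const)
      rw [ae_restrict_iff' measurableSet_Icc] at hg
      filter_upwards [hg] with τ hτ hm
      have := hτ ⟨hm.1.le, hm.2.trans ht.2⟩
      calc _ ≤ ‖S (t - τ)‖ * ‖g τ‖ := (S (t - τ)).le_opNorm _
        _ ≤ C * (L * ‖d τ‖ + κ) := mul_le_mul (hC _) this (norm_nonneg _) hC0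
        _ = _ := by ring
    rw [intervalIntegral.integral_add (hii.const_mul _) intervalIntegrable_const,
      intervalIntegral.integral_const_mul, intervalIntegral.integral_const, smul_eq_mul] at h1
    have h2 : (t - s) * (C * κ) ≤ C * κ * (T - s) := by
      rw [mul_comm]; exact mul_le_mul_of_nonneg_left (by linarith [ht.2]) (by positivity)
    have h3 : ‖d t‖ ≤ ‖c t‖ + ‖∫ τ in s..t, S (t - τ) (g τ)‖ := by
      rw [h t ht]; exact norm_add_le _ _
    have := hc t ht
    show ‖d t‖ ≤ _
    linarith

/-- Solution operator of the linear Volterra equation. -/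
theorem aux_linear {X : Type*} [NormedAddCommGroup X] [NormedSpace ℝ X] [CompleteSpace X]
    {s T C L : ℝ} (hsT : s ≤ T) (S : ℝ → X →L[ℝ] X) (hS : ∀ x, Continuous fun σ => S σ x)
    (hC : ∀ σ, ‖S σ‖ ≤ C) (hL : 0 ≤ L)
    (B : ℝ → X →L[ℝ] X)
    (hBm : ∀ v, AEStronglyMeasurable (fun τ => B τ v) (volume.restrict (Icc s T)))
    (hBL : ∀ᵐ τ ∂(volume.restrict (Icc s T)), ‖B τ‖ ≤ L) :
    ∃ J : ℝ → X →L[ℝ] X, ∀ h, ContinuousOn (fun t => J t h) (Icc s T) ∧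
      ∀ t ∈ Icc s T, J t h = S (t - s) h + ∫ τ in s..t, S (t - τ) (B τ (J τ h)) := by
  have hC0 : 0 ≤ C := (norm_nonneg _).trans (hC 0)
  set lam : ℝ := C * L + 1 with hlam
  have hlam0 : 0 < lam := by positivity
  -- the unweighted path attached to `w`
  let Z : C(Icc s T, X) → ℝ → X := fun w τ =>
    Real.exp (lam * (τ - s)) • w (projIcc s T hsT τ)
  have hZc : ∀ w, Continuous (Z w) := fun w =>
    (by fun_prop : Continuous fun τ : ℝ => Real.exp (lam * (τ - s))).smul
      (w.continuous.comp continuous_projIcc)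
  have hZn : ∀ w τ, ‖Z w τ‖ ≤ Real.exp (lam * (τ - s)) * ‖w‖ := by
    intro w τ
    simp only [Z, norm_smul, Real.norm_eq_abs, Real.abs_exp]
    exact mul_le_mul_of_nonneg_left (w.norm_coe_le_norm _) (Real.exp_nonneg _)
  have hBZm : ∀ w, AEStronglyMeasurable (fun τ => B τ (Z w τ)) (volume.restrict (Icc s T)) :=
    fun w => aux_meas (fun τ v => B τ v) hBm (Filter.Eventually.of_forall fun τ => (B τ).continuous)
      (Z w) (hZc w).aestronglyMeasurable
  have hBZ1 : ∀ w, ∀ᵐ τ ∂(volume.restrict (Icc s T)),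
      ‖B τ (Z w τ)‖ ≤ L * (Real.exp (lam * (τ - s)) * ‖w‖) := by
    intro w
    filter_upwards [hBL] with τ hτ
    exact ((B τ).le_opNorm _).trans (mul_le_mul hτ (hZn w τ) (norm_nonneg _) hL)
  have hBZ2 : ∀ w, ∀ᵐ τ ∂(volume.restrict (Icc s T)),
      ‖B τ (Z w τ)‖ ≤ L * (Real.exp (lam * (T - s)) * ‖w‖) := by
    intro w
    filter_upwards [hBZ1 w, ae_restrict_mem measurableSet_Icc] with τ hτ hm
    refine hτ.trans ?_
    have := hm.2
    gcongr
  let V : C(Icc s T, X) → ℝ → X := fun w t => ∫ τ in s..t, S (t - τ) (B τ (Z w τ))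
  have hVint : ∀ w, ∀ t ∈ Icc s T,
      IntervalIntegrable (fun τ => S (t - τ) (B τ (Z w τ))) volume s t :=
    fun w t ht => aux_int S hS hC _ (hBZm w) (hBZ2 w) t ht
  have hVc : ∀ w, ContinuousOn (V w) (Icc s T) := fun w =>
    aux_cont S hS hC _ (hBZm w) (hBZ2 w)
  have hVn : ∀ w, ∀ t ∈ Icc s T, ‖V w t‖ ≤ C * L / lam * ‖w‖ * Real.exp (lam * (t - s)) := by
    intro w t ht
    have h1 : ‖V w t‖ ≤ ∫ τ in s..t, C * L * ‖w‖ * Real.exp (lam * (τ - s)) := by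
      refine intervalIntegral.norm_integral_le_of_norm_le ht.1 ?_
        (Continuous.intervalIntegrable (by fun_prop) _ _)
      have := hBZ1 w
      rw [ae_restrict_iff' measurableSet_Icc] at this
      filter_upwards [this] with τ hτ hm
      have := hτ ⟨hm.1.le, hm.2.trans ht.2⟩
      calc _ ≤ ‖S (t - τ)‖ * ‖B τ (Z w τ)‖ := (S (t - τ)).le_opNorm _
        _ ≤ C * (L * (Real.exp (lam * (τ - s)) * ‖w‖)) :=
          mul_le_mul (hC _) this (norm_nonneg _) hC0
        _ = _ := by ring
    have h2 : ∫ τ in s..t, C * L * ‖w‖ * Real.exp (lam * (τ - s)) =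
        C * L * ‖w‖ * Real.exp (lam * (t - s)) / lam - C * L * ‖w‖ / lam := by
      have hd : ∀ τ ∈ uIcc s t, HasDerivAt
          (fun τ => C * L * ‖w‖ * Real.exp (lam * (τ - s)) / lam)
          (C * L * ‖w‖ * Real.exp (lam * (τ - s))) τ := by
        intro τ _
        have h3 : HasDerivAt (fun τ : ℝ => lam * (τ - s)) (lam * 1) τ :=
          ((hasDerivAt_id τ).sub_const s).const_mul lam
        have h4 := (h3.exp.const_mul (C * L * ‖w‖)).div_const lam
        exact h4.congr_deriv (by field_simp)
      rw [intervalIntegral.integral_eq_sub_of_hasDerivAt hd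
        (Continuous.intervalIntegrable (by fun_prop) _ _)]
      simp
    rw [h2] at h1
    have h5 : 0 ≤ C * L * ‖w‖ / lam := by positivity
    calc _ ≤ _ := h1
      _ ≤ C * L * ‖w‖ * Real.exp (lam * (t - s)) / lam := by linarith
      _ = _ := by ring
  let Kl : C(Icc s T, X) →ₗ[ℝ] C(Icc s T, X) :=
    { toFun := fun w => ⟨fun t => Real.exp (-(lam * ((t : ℝ) - s))) • V w t, by
        refine Continuous.smul (by fun_prop) ?_
        exact continuousOn_iff_continuous_domRestrict.1 (hVc w)⟩
      map_add' := by
        intro w₁ w₂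
        ext t
        simp only [ContinuousMap.coe_mk, ContinuousMap.add_apply, ← smul_add]
        congr 1
        rw [← intervalIntegral.integral_add (hVint w₁ t t.2) (hVint w₂ t t.2)]
        simp [V, Z]
      map_smul' := by
        intro r w
        ext t
        simp only [ContinuousMap.coe_mk, ContinuousMap.smul_apply, RingHom.id_apply]
        rw [smul_comm]
        congr 1
        rw [← intervalIntegral.integral_smul]
        refine intervalIntegral.integral_congr fun τ _ => ?_
        simp only [Z, ContinuousMap.smul_apply, map_smul]
        rw [smul_comm] }
  have hKn : ∀ w, ‖Kl w‖ ≤ C * L / lam * ‖w‖ := by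
    intro w
    rw [ContinuousMap.norm_le _ (by positivity)]
    intro t
    show ‖Real.exp (-(lam * ((t : ℝ) - s))) • V w t‖ ≤ _
    rw [norm_smul, Real.norm_eq_abs, Real.abs_exp]
    calc _ ≤ Real.exp (-(lam * ((t : ℝ) - s))) *
          (C * L / lam * ‖w‖ * Real.exp (lam * (t - s))) :=
          mul_le_mul_of_nonneg_left (hVn w t t.2) (Real.exp_nonneg _)
      _ = C * L / lam * ‖w‖ * (Real.exp (-(lam * ((t : ℝ) - s))) * Real.exp (lam * (t - s))) := by
          ring
      _ = _ := by rw [← Real.exp_add]; simp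
  let K : C(Icc s T, X) →L[ℝ] C(Icc s T, X) := Kl.mkContinuous _ hKn
  have hK1 : ‖K‖ < 1 := by
    refine (Kl.mkContinuous_norm_le (by positivity) hKn).trans_lt ?_
    rw [div_lt_one hlam0]; linarith
  obtain ⟨Q, hQ⟩ := isUnit_one_sub_of_norm_lt_one
    (R := C(Icc s T, X) →L[ℝ] C(Icc s T, X)) (x := K) hK1
  let R : X →L[ℝ] C(Icc s T, X) := LinearMap.mkContinuous
    { toFun := fun h => ⟨fun t => Real.exp (-(lam * ((t : ℝ) - s))) • S ((t : ℝ) - s) h, by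
        refine Continuous.smul (by fun_prop) ?_
        exact (hS h).comp (by fun_prop)⟩
      map_add' := by intro a b; ext t; simp
      map_smul' := by 
        intro r a; ext t
        simp only [map_smul, ContinuousMap.coe_mk, ContinuousMap.smul_apply, RingHom.id_apply]
        rw [smul_comm] } C (by
      intro h
      rw [ContinuousMap.norm_le _ (by positivity)]
      intro t
      show ‖Real.exp (-(lam * ((t : ℝ) - s))) • S ((t : ℝ) - s) h‖ ≤ _
      rw [norm_smul, Real.norm_eq_abs, Real.abs_exp]
      have h1 : Real.exp (-(lam * ((t : ℝ) - s))) ≤ 1 := by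
        rw [Real.exp_le_one_iff]
        have := t.2.1
        have : 0 ≤ lam * ((t : ℝ) - s) := mul_nonneg hlam0.le (by linarith)
        linarith
      calc _ ≤ 1 * ‖S ((t : ℝ) - s) h‖ := mul_le_mul_of_nonneg_right h1 (norm_nonneg _)
        _ ≤ C * ‖h‖ := by
          rw [one_mul]
          exact ((S _).le_opNorm _).trans (mul_le_mul_of_nonneg_right (hC _) (norm_nonneg _)))
  let W : X →L[ℝ] C(Icc s T, X) := (↑Q⁻¹ : C(Icc s T, X) →L[ℝ] C(Icc s T, X)).comp R
  have hW : ∀ h, W h = R h + K (W h) := by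
    intro h
    have h1 : ((1 : C(Icc s T, X) →L[ℝ] C(Icc s T, X)) - K) (W h) = R h := by
      rw [← hQ]
      show ((↑Q : C(Icc s T, X) →L[ℝ] C(Icc s T, X)) * ↑Q⁻¹) (R h) = R h
      rw [Units.mul_inv]; rfl
    have h2 : W h - K (W h) = R h := h1
    rw [← h2]; simp
  refine ⟨fun t => Real.exp (lam * (t - s)) •
    ((ContinuousMap.evalCLM ℝ (projIcc s T hsT t)).comp W), fun h => ⟨?_, ?_⟩⟩
  · exact (hZc (W h)).continuousOn
  · intro t ht
    show Real.exp (lam * (t - s)) • (W h) (projIcc s T hsT t) = S (t - s) h + V (W h) t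
    have hWt := DFunLike.congr_fun (hW h) ⟨t, ht⟩
    rw [projIcc_of_mem hsT ht, hWt]
    show Real.exp (lam * (t - s)) • (Real.exp (-(lam * (t - s))) • S (t - s) h
      + Real.exp (-(lam * (t - s))) • V (W h) t) = _
    rw [smul_add, smul_smul, smul_smul, ← Real.exp_add]
    simp

theorem aux_core {X : Type*} [NormedAddCommGroup X] [NormedSpace ℝ X] [CompleteSpace X]
    {s T C L : ℝ} (hsT : s ≤ T) (S : ℝ → X →L[ℝ] X) (hS : ∀ x, Continuous fun σ => S σ x)
    (hC : ∀ σ, ‖S σ‖ ≤ C) (hL : 0 ≤ L)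
    (F : ℝ → X → X) (B : ℝ → X → X →L[ℝ] X)
    (hFm : ∀ x, AEStronglyMeasurable (fun τ => F τ x) (volume.restrict (Icc s T)))
    (hBm : ∀ x v, AEStronglyMeasurable (fun τ => B τ x v) (volume.restrict (Icc s T)))
    (hF : ∀ᵐ τ ∂(volume.restrict (Icc s T)), (∀ x, HasFDerivAt (F τ) (B τ x) x) ∧
      (∀ x, ‖B τ x‖ ≤ L) ∧ (∀ x y, ‖B τ x - B τ y‖ ≤ L * ‖x - y‖) ∧ ‖F τ 0‖ ≤ L)
    (Φ : ℝ → X → X) (hΦc : ∀ x, ContinuousOn (fun t => Φ t x) (Icc s T))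
    (hΦ : ∀ x, ∀ t ∈ Icc s T, Φ t x = S (t - s) x + ∫ τ in s..t, S (t - τ) (F τ (Φ τ x)))
    (x : X) :
    ∃ J : ℝ → X →L[ℝ] X, (∀ t ∈ Icc s T, HasFDerivAt (Φ t) (J t) x) ∧
      ∀ h, ContinuousOn (fun t => J t h) (Icc s T) ∧
        (∀ t ∈ Icc s T, J t h = S (t - s) h + ∫ τ in s..t, S (t - τ) (B τ (Φ τ x) (J τ h))) ∧
        ∀ z : ℝ → X, ContinuousOn z (Icc s T) →
          (∀ t ∈ Icc s T, z t = S (t - s) h + ∫ τ in s..t, S (t - τ) (B τ (Φ τ x) (z τ))) →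
          ∀ t ∈ Icc s T, z t = J t h := by
  have hC0 : 0 ≤ C := (norm_nonneg _).trans (hC 0)
  have hFlip : ∀ᵐ τ ∂(volume.restrict (Icc s T)), ∀ y z, ‖F τ y - F τ z‖ ≤ L * ‖y - z‖ := by
    filter_upwards [hF] with τ hτ y z
    exact convex_univ.norm_image_sub_le_of_norm_hasFDerivWithin_le
      (fun y _ => (hτ.1 y).hasFDerivWithinAt) (fun y _ => hτ.2.1 y) (mem_univ z) (mem_univ y)
  have hFrem : ∀ᵐ τ ∂(volume.restrict (Icc s T)), ∀ y z,
      ‖F τ z - F τ y - B τ y (z - y)‖ ≤ L * ‖z - y‖ * ‖z - y‖ := by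
    filter_upwards [hF] with τ hτ y z
    refine (convex_closedBall y ‖z - y‖).norm_image_sub_le_of_norm_hasFDerivWithin_le'
      (f' := B τ) (fun y _ => (hτ.1 y).hasFDerivWithinAt) (fun w hw => ?_) (by simp)
      (by simp [dist_eq_norm])
    refine (hτ.2.2.1 w y).trans (mul_le_mul_of_nonneg_left ?_ hL)
    rwa [mem_closedBall_iff_norm] at hw
  -- measurability of compositions
  have hcm : ∀ φ : ℝ → X, ContinuousOn φ (Icc s T) →
      AEStronglyMeasurable φ (volume.restrict (Icc s T)) := fun φ hφ =>
    hφ.aestronglyMeasurable measurableSet_Icc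
  have hbd : ∀ φ : ℝ → X, ContinuousOn φ (Icc s T) → ∃ K, ∀ t ∈ Icc s T, ‖φ t‖ ≤ K :=
    fun φ hφ => isCompact_Icc.exists_bound_of_continuousOn hφ
  have hFint : ∀ y, ∀ t ∈ Icc s T,
      IntervalIntegrable (fun τ => S (t - τ) (F τ (Φ τ y))) volume s t := by
    intro y t ht
    obtain ⟨K, hK⟩ := hbd _ (hΦc y)
    refine aux_int (K := L + L * K) S hS hC _ (aux_meas F hFm ?_ _ (hcm _ (hΦc y))) ?_ t ht
    · filter_upwards [hF] with τ hτ
      exact continuous_iff_continuousAt.2 fun x => (hτ.1 x).continuousAt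
    · filter_upwards [hF, hFlip, ae_restrict_mem measurableSet_Icc] with τ hτ h2 hm
      have h3 := h2 (Φ τ y) 0
      rw [sub_zero] at h3
      have h4 := norm_sub_norm_le (F τ (Φ τ y)) (F τ 0)
      have h5 := mul_le_mul_of_nonneg_left (hK τ hm) hL
      linarith [hτ.2.2.2]
  have hBx : ∀ v, AEStronglyMeasurable (fun τ => B τ (Φ τ x) v) (volume.restrict (Icc s T)) := by
    intro v
    refine aux_meas (fun τ y => B τ y v) (fun y => hBm y v) ?_ _ (hcm _ (hΦc x))
    filter_upwards [hF] with τ hτ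
    have h1 : LipschitzWith ⟨L, hL⟩ (B τ) := LipschitzWith.of_dist_le_mul fun y z => by
      rw [dist_eq_norm, dist_eq_norm]; exact hτ.2.2.1 y z
    exact (ContinuousLinearMap.apply ℝ X v).continuous.comp h1.continuous
  have hBL : ∀ᵐ τ ∂(volume.restrict (Icc s T)), ‖B τ (Φ τ x)‖ ≤ L := by
    filter_upwards [hF] with τ hτ using hτ.2.1 _
  have hBint : ∀ z : ℝ → X, ContinuousOn z (Icc s T) → ∀ t ∈ Icc s T,
      IntervalIntegrable (fun τ => S (t - τ) (B τ (Φ τ x) (z τ))) volume s t := by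
    intro z hz t ht
    obtain ⟨K, hK⟩ := hbd _ hz
    refine aux_int (K := L * K) S hS hC _ (aux_meas (fun τ v => B τ (Φ τ x) v) hBx
      (Filter.Eventually.of_forall fun τ => (B τ (Φ τ x)).continuous) _ (hcm _ hz)) ?_ t ht
    filter_upwards [hBL, ae_restrict_mem measurableSet_Icc] with τ hτ hm
    exact ((B τ (Φ τ x)).le_opNorm _).trans (mul_le_mul hτ (hK τ hm) (norm_nonneg _) hL)
  obtain ⟨J, hJ⟩ := aux_linear hsT S hS hC hL (fun τ => B τ (Φ τ x)) hBx hBL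
  set E := Real.exp (C * L * (T - s)) with hE
  have hE0 : 0 ≤ E := Real.exp_nonneg _
  have hTs : 0 ≤ T - s := by linarith
  -- Lipschitz dependence on initial data
  have hlip : ∀ y, ∀ t ∈ Icc s T, ‖Φ t y - Φ t x‖ ≤ C * ‖y - x‖ * E := by
    intro y t ht
    have := aux_est (a := C * ‖y - x‖) (κ := 0) S hC hL le_rfl
      (fun τ => F τ (Φ τ y) - F τ (Φ τ x)) (fun t => Φ t y - Φ t x) (fun t => S (t - s) (y - x))
      ((hΦc y).sub (hΦc x)) ?_ ?_ ?_ t ht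
    · simpa using this
    · filter_upwards [hFlip] with τ hτ
      simpa using hτ _ _
    · intro t _
      exact ((S _).le_opNorm _).trans (mul_le_mul_of_nonneg_right (hC _) (norm_nonneg _))
    · intro t ht
      simp only [map_sub]
      rw [intervalIntegral.integral_sub (hFint y t ht) (hFint x t ht), hΦ y t ht, hΦ x t ht]
      abel
  refine ⟨J, ?_, fun h => ⟨(hJ h).1, (hJ h).2, ?_⟩⟩
  · intro t ht
    set D := C * (L * (C * E) ^ 2) * (T - s) * E with hD
    have hrem : ∀ y, ‖Φ t y - Φ t x - J t (y - x)‖ ≤ D * ‖y - x‖ ^ 2 := by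
      intro y
      have := aux_est (a := 0) (κ := L * (C * E) ^ 2 * ‖y - x‖ ^ 2) S hC hL (by positivity)
        (fun τ => F τ (Φ τ y) - F τ (Φ τ x) - B τ (Φ τ x) (J τ (y - x)))
        (fun t => Φ t y - Φ t x - J t (y - x)) (fun t => 0)
        (((hΦc y).sub (hΦc x)).sub (hJ _).1) ?_ ?_ ?_ t ht
      · refine this.trans (le_of_eq ?_)
        rw [hD]; ring
      · filter_upwards [hFrem, hBL, ae_restrict_mem measurableSet_Icc] with τ h1 h2 hm
        have h3 := h1 (Φ τ x) (Φ τ y)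
        have h4 := hlip y τ hm
        have h5 : F τ (Φ τ y) - F τ (Φ τ x) - B τ (Φ τ x) (J τ (y - x)) =
            B τ (Φ τ x) (Φ τ y - Φ τ x - J τ (y - x)) +
              (F τ (Φ τ y) - F τ (Φ τ x) - B τ (Φ τ x) (Φ τ y - Φ τ x)) := by
          rw [map_sub (B τ (Φ τ x)) (Φ τ y - Φ τ x)]; abel
        rw [h5]
        refine (norm_add_le _ _).trans (add_le_add ?_ ?_)
        · exact ((B τ (Φ τ x)).le_opNorm _).trans (mul_le_mul_of_nonneg_right h2 (norm_nonneg _))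
        · calc _ ≤ _ := h3
            _ ≤ L * (C * ‖y - x‖ * E) * (C * ‖y - x‖ * E) := by gcongr
            _ = _ := by ring
      · intro t _; simp
      · intro t ht
        have hi := intervalIntegral.integral_sub (μ := volume)
          ((hFint y t ht).sub (hFint x t ht)) (hBint _ (hJ (y - x)).1 t ht)
        have hi2 := intervalIntegral.integral_sub (hFint y t ht) (hFint x t ht)
        simp only [map_sub _ (F _ _) (F _ _), map_sub _ (_ - _) (B _ _ _)]
        refine Eq.trans ?_ (congrArg (fun v => (0 : X) + v) hi.symm)
        rw [hi2, hΦ y t ht, hΦ x t ht, (hJ (y - x)).2 t ht, map_sub]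
        abel
    have h0 : HasFDerivAt (fun y => Φ t y - Φ t x - J t (y - x)) (0 : X →L[ℝ] X) x := by
      refine Asymptotics.IsBigO.hasFDerivAt (n := 2) ?_ (by norm_num)
      refine Asymptotics.IsBigO.of_bound D (Filter.Eventually.of_forall fun y => ?_)
      simpa using hrem y
    have h1 : HasFDerivAt (fun y => J t (y - x)) (J t) x := by
      simpa using (J t).hasFDerivAt
    have h2 := (h0.add h1).add_const (Φ t x)
    rw [zero_add] at h2
    refine h2.congr_of_eventuallyEq (Filter.Eventually.of_forall fun y => ?_)
    simp
  · intro z hz hzeq t ht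
    have := aux_est (a := 0) (κ := 0) S hC hL le_rfl
      (fun τ => B τ (Φ τ x) (z τ) - B τ (Φ τ x) (J τ h)) (fun t => z t - J t h) (fun t => 0)
      (hz.sub (hJ h).1) ?_ ?_ ?_ t ht
    · simpa [sub_eq_zero] using this
    · filter_upwards [hBL] with τ hτ
      rw [← map_sub, add_zero]
      exact ((B τ (Φ τ x)).le_opNorm _).trans (mul_le_mul_of_nonneg_right hτ (norm_nonneg _))
    · intro t _; simp
    · intro t ht
      have hi := intervalIntegral.integral_sub (hBint _ hz t ht) (hBint _ (hJ h).1 t ht)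
      simp only [map_sub (S _)]
      rw [hi, hzeq t ht, (hJ h).2 t ht]
      abel

/-- under (A) and (A+), for every `0 ≤ s ≤ t ≤ T` the map `x ↦ Φ̄_{s,t}(x)`
is Fréchet differentiable, and for every `h` the map `t ↦ D_xΦ̄_{s,t}(x) h` is the unique
mild solution of the variational equation. -/
theorem mild_flow_frechet_differentiable
    {X : Type*} [NormedAddCommGroup X] [NormedSpace ℝ X] [CompleteSpace X]
    {m : ℕ} {T : ℝ} (hT : 0 < T)
    (S : ℝ → X →L[ℝ] X)
    (hS0 : S 0 = ContinuousLinearMap.id ℝ X)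
    (hSadd : ∀ a b : ℝ, 0 ≤ a → 0 ≤ b → S (a + b) = (S a).comp (S b))
    (hScont : ∀ x : X, ContinuousOn (fun σ => S σ x) (Set.Ici (0 : ℝ)))
    (U : Set (EuclideanSpace ℝ (Fin m))) (hUcpt : IsCompact U) (hUcvx : Convex ℝ U)
    (f : ℝ → X → X) (G : ℝ → X → EuclideanSpace ℝ (Fin m) →L[ℝ] X)
    {Mf MG : ℝ} (hMf : 0 ≤ Mf) (hMG : 0 ≤ MG)
    (hfmeas : ∀ x : X,
      AEStronglyMeasurable (fun t => f t x) (volume.restrict (Set.Icc (0:ℝ) T)))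
    (hGmeas : ∀ x : X,
      AEStronglyMeasurable (fun t => G t x) (volume.restrict (Set.Icc (0:ℝ) T)))
    (hA : ∀ᵐ t ∂(volume.restrict (Set.Icc (0:ℝ) T)),
        (∀ x y : X, ‖f t x - f t y‖ ≤ Mf * ‖x - y‖) ∧
        (∀ x y : X, ‖G t x - G t y‖ ≤ MG * ‖x - y‖) ∧
        ‖f t 0‖ ≤ Mf ∧ ‖G t 0‖ ≤ MG)
    {M : ℝ} (hM : 0 ≤ M)
    (hDfmeas : ∀ x : X,
      AEStronglyMeasurable (fun t => fderiv ℝ (f t) x) (volume.restrict (Set.Icc (0:ℝ) T)))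
    (hDGmeas : ∀ x : X,
      AEStronglyMeasurable (fun t => fderiv ℝ (G t) x) (volume.restrict (Set.Icc (0:ℝ) T)))
    (hAplus : ∀ᵐ t ∂(volume.restrict (Set.Icc (0:ℝ) T)),
        ContDiff ℝ 1 (f t) ∧ ContDiff ℝ 1 (G t) ∧
        (∀ x : X, ‖fderiv ℝ (f t) x‖ ≤ M) ∧
        (∀ x : X, ‖fderiv ℝ (G t) x‖ ≤ M) ∧
        (∀ x y : X, ‖fderiv ℝ (f t) x - fderiv ℝ (f t) y‖ ≤ M * ‖x - y‖) ∧
        (∀ x y : X, ‖fderiv ℝ (G t) x - fderiv ℝ (G t) y‖ ≤ M * ‖x - y‖))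
    (ubar : ℝ → EuclideanSpace ℝ (Fin m))
    (hubar_meas : AEStronglyMeasurable ubar (volume.restrict (Set.Icc (0:ℝ) T)))
    (hubar_mem : ∀ᵐ t ∂(volume.restrict (Set.Icc (0:ℝ) T)), ubar t ∈ U)
    (Φ : ℝ → ℝ → X → X)
    (hΦ : ∀ s ∈ Set.Icc (0:ℝ) T, ∀ x : X,
      IsMildSol T S (fun τ y => f τ y + G τ y (ubar τ)) s x (fun t => Φ s t x)) :
    ∀ s ∈ Set.Icc (0:ℝ) T,
      (∀ t ∈ Set.Icc s T, ∀ x : X, DifferentiableAt ℝ (Φ s t) x) ∧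
      (∀ x h : X,
        ContinuousOn (fun t => fderiv ℝ (Φ s t) x h) (Set.Icc s T) ∧
        (∀ t ∈ Set.Icc s T,
          fderiv ℝ (Φ s t) x h = S (t - s) h +
            ∫ τ in s..t, S (t - τ)
              (fderiv ℝ (f τ) (Φ s τ x) (fderiv ℝ (Φ s τ) x h) +
                (fderiv ℝ (G τ) (Φ s τ x) (fderiv ℝ (Φ s τ) x h)) (ubar τ))) ∧
        (∀ z : ℝ → X, ContinuousOn z (Set.Icc s T) →
          (∀ t ∈ Set.Icc s T,
            z t = S (t - s) h +
              ∫ τ in s..t, S (t - τ)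
                (fderiv ℝ (f τ) (Φ s τ x) (z τ) +
                  (fderiv ℝ (G τ) (Φ s τ x) (z τ)) (ubar τ))) →
          ∀ t ∈ Set.Icc s T, z t = fderiv ℝ (Φ s t) x h)) := by
  obtain ⟨R, hR⟩ := hUcpt.isBounded.exists_norm_le
  set R' : ℝ := max R 0 with hR'
  have hR0 : 0 ≤ R' := le_max_right _ _
  have hub : ∀ᵐ t ∂(volume.restrict (Set.Icc (0:ℝ) T)), ‖ubar t‖ ≤ R' := by
    filter_upwards [hubar_mem] with t ht using (hR _ ht).trans (le_max_left _ _)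
  -- the extended semigroup
  let St : ℝ → X →L[ℝ] X := fun σ => S (projIcc 0 T hT.le σ)
  have hSt : ∀ σ ∈ Icc (0:ℝ) T, St σ = S σ := fun σ hσ => by
    simp only [St, projIcc_of_mem hT.le hσ]
  have hStc : ∀ x, Continuous fun σ => St σ x := fun x =>
    (hScont x).comp_continuous (continuous_subtype_val.comp continuous_projIcc)
      (fun σ => (projIcc 0 T hT.le σ).2.1)
  obtain ⟨C, hC⟩ : ∃ C, ∀ σ, ‖St σ‖ ≤ C := by
    refine banach_steinhaus fun x => ?_
    obtain ⟨K, hK⟩ := isCompact_Icc.exists_bound_of_continuousOn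
      ((hScont x).mono (Icc_subset_Ici_self : Icc 0 T ⊆ Ici 0))
    exact ⟨K, fun σ => hK _ (projIcc 0 T hT.le σ).2⟩
  intro s hs
  have hsT : s ≤ T := hs.2
  have hμ : volume.restrict (Icc s T) ≤ volume.restrict (Icc (0:ℝ) T) :=
    Measure.restrict_mono (Icc_subset_Icc_left hs.1) le_rfl
  have hint : ∀ t ∈ Icc s T, ∀ g : ℝ → X,
      ∫ τ in s..t, S (t - τ) (g τ) = ∫ τ in s..t, St (t - τ) (g τ) := by
    intro t ht g
    refine intervalIntegral.integral_congr fun τ hτ => ?_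
    rw [uIcc_of_le ht.1] at hτ
    rw [hSt (t - τ) ⟨by linarith [hτ.2], by linarith [hτ.1, hs.1, ht.2]⟩]
  have hSts : ∀ t ∈ Icc s T, S (t - s) = St (t - s) := fun t ht =>
    (hSt _ ⟨by linarith [ht.1], by linarith [hs.1, ht.2]⟩).symm
  let F : ℝ → X → X := fun τ y => f τ y + G τ y (ubar τ)
  let ev : EuclideanSpace ℝ (Fin m) →
      (EuclideanSpace ℝ (Fin m) →L[ℝ] X) →L[ℝ] X := fun u => ContinuousLinearMap.apply ℝ X u
  let B : ℝ → X → X →L[ℝ] X := fun τ y =>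
    fderiv ℝ (f τ) y + (ev (ubar τ)).comp (fderiv ℝ (G τ) y)
  have hevn : ∀ u, ‖ev u‖ ≤ ‖u‖ := fun u =>
    ContinuousLinearMap.opNorm_le_bound _ (norm_nonneg _) fun A => by
      rw [mul_comm]; exact A.le_opNorm u
  set L : ℝ := max (M * (1 + R')) (Mf + MG * R') with hL
  have hL0 : 0 ≤ L := le_max_of_le_left (by positivity)
  have hFm : ∀ x, AEStronglyMeasurable (fun τ => F τ x) (volume.restrict (Icc s T)) := by
    intro x
    refine AEStronglyMeasurable.mono_measure ?_ hμ
    refine (hfmeas x).add ?_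
    exact (ContinuousLinearMap.id ℝ (EuclideanSpace ℝ (Fin m) →L[ℝ] X)).aestronglyMeasurable_comp₂
      (hGmeas x) hubar_meas
  have hBm : ∀ x v, AEStronglyMeasurable (fun τ => B τ x v) (volume.restrict (Icc s T)) := by
    intro x v
    refine AEStronglyMeasurable.mono_measure ?_ hμ
    refine AEStronglyMeasurable.add ((hDfmeas x).apply_continuousLinearMap v) ?_
    exact (ContinuousLinearMap.id ℝ (EuclideanSpace ℝ (Fin m) →L[ℝ] X)).aestronglyMeasurable_comp₂
      ((hDGmeas x).apply_continuousLinearMap v) hubar_meas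
  have hF : ∀ᵐ τ ∂(volume.restrict (Icc s T)), (∀ x, HasFDerivAt (F τ) (B τ x) x) ∧
      (∀ x, ‖B τ x‖ ≤ L) ∧ (∀ x y, ‖B τ x - B τ y‖ ≤ L * ‖x - y‖) ∧ ‖F τ 0‖ ≤ L := by
    refine ae_mono hμ ?_
    filter_upwards [hA, hAplus, hub] with τ h1 h2 hu
    obtain ⟨-, -, hf0, hG0⟩ := h1
    obtain ⟨hfd, hGd, hfb, hGb, hfl, hGl⟩ := h2
    refine ⟨fun x => ?_, fun x => ?_, fun x y => ?_, ?_⟩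
    · have a1 := ((hfd.differentiable one_ne_zero) x).hasFDerivAt
      have a2 := ((hGd.differentiable one_ne_zero) x).hasFDerivAt
      exact a1.add ((ev (ubar τ)).hasFDerivAt.comp x a2)
    · calc ‖B τ x‖ ≤ ‖fderiv ℝ (f τ) x‖ + ‖(ev (ubar τ)).comp (fderiv ℝ (G τ) x)‖ :=
            norm_add_le _ _
        _ ≤ M + R' * M := by
          refine add_le_add (hfb x) ((ContinuousLinearMap.opNorm_comp_le _ _).trans ?_)
          exact mul_le_mul ((hevn _).trans hu) (hGb x) (norm_nonneg _) hR0
        _ = M * (1 + R') := by ring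
        _ ≤ L := le_max_left _ _
    · have e : B τ x - B τ y = (fderiv ℝ (f τ) x - fderiv ℝ (f τ) y) +
          (ev (ubar τ)).comp (fderiv ℝ (G τ) x - fderiv ℝ (G τ) y) := by
        simp only [B, ContinuousLinearMap.comp_sub]; abel
      rw [e]
      calc _ ≤ ‖fderiv ℝ (f τ) x - fderiv ℝ (f τ) y‖ +
            ‖(ev (ubar τ)).comp (fderiv ℝ (G τ) x - fderiv ℝ (G τ) y)‖ := norm_add_le _ _
        _ ≤ M * ‖x - y‖ + R' * (M * ‖x - y‖) := by
          refine add_le_add (hfl x y) ((ContinuousLinearMap.opNorm_comp_le _ _).trans ?_)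
          exact mul_le_mul ((hevn _).trans hu) (hGl x y) (norm_nonneg _) hR0
        _ = M * (1 + R') * ‖x - y‖ := by ring
        _ ≤ L * ‖x - y‖ := mul_le_mul_of_nonneg_right (le_max_left _ _) (norm_nonneg _)
    · calc ‖F τ 0‖ ≤ ‖f τ 0‖ + ‖G τ 0 (ubar τ)‖ := norm_add_le _ _
        _ ≤ Mf + MG * R' := by
          refine add_le_add hf0 (((G τ 0).le_opNorm _).trans ?_)
          exact mul_le_mul hG0 hu (norm_nonneg _) hMG
        _ ≤ L := le_max_right _ _
  have core := aux_core hsT St hStc hC hL0 F B hFm hBm hF (Φ s) (fun x => (hΦ s hs x).1)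
    (fun x t ht => by
      rw [← hint t ht, ← hSts t ht]
      exact (hΦ s hs x).2 t ht)
  refine ⟨fun t ht x => ?_, fun x h => ?_⟩
  · obtain ⟨J, hJ, -⟩ := core x
    exact (hJ t ht).differentiableAt
  · obtain ⟨J, hJ, hJ2⟩ := core x
    obtain ⟨hc, heq, huniq⟩ := hJ2 h
    have hfd : ∀ t ∈ Icc s T, fderiv ℝ (Φ s t) x h = J t h := fun t ht => by
      rw [(hJ t ht).fderiv]
    refine ⟨hc.congr hfd, fun t ht => ?_, fun z hz hzeq t ht => ?_⟩
    · rw [hfd t ht, heq t ht, ← hint t ht, ← hSts t ht]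
      congr 1
      refine intervalIntegral.integral_congr fun τ hτ => ?_
      rw [uIcc_of_le ht.1] at hτ
      rw [hfd τ ⟨hτ.1, hτ.2.trans ht.2⟩]
      rfl
    · rw [hfd t ht]
      refine huniq z hz (fun t ht => ?_) t ht
      rw [← hint t ht, ← hSts t ht]
      exact hzeq t ht
end
end

section
/- Assume (A) and the finite-channel structure (C): G_t(x) u = Σ_{j=1}^m (uᵀ g^j_t(x)) h^j, where each g^j : I × X → ℝ^m is strongly measurable in t, Lipschitz in x and bounded at 0 with uniform constants as in (A), and h^1, …, h^m ∈ X are fixed vectors. Fix x₀ ∈ X and let x^u denote the mild solution of the state equation on I with x^u_0 = x₀ and control u. If a sequence (u^n) ⊂ 𝒰 converges to u ∈ 𝒰 in the weak* topology σ(L^∞, L^1) of L^∞(I; ℝ^m), then x^{u^n} → x^u in C(I; X) (i.e. uniformly on I). -/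
open MeasureTheory Set Filter
open scoped RealInnerProductSpace

noncomputable section

/-- A control is admissible (belongs to `𝒰 = L^∞(I;U)`) if it is strongly measurable on
`I = [0,T]` and takes values in `U` a.e. on `I`. -/
def Admissible {m : ℕ} (T : ℝ) (U : Set (EuclideanSpace ℝ (Fin m)))
    (u : ℝ → EuclideanSpace ℝ (Fin m)) : Prop :=
  AEStronglyMeasurable u (volume.restrict (Set.Icc (0:ℝ) T)) ∧
    ∀ᵐ t ∂(volume.restrict (Set.Icc (0:ℝ) T)), u t ∈ U

lemma aux_bound {X : Type*} [NormedAddCommGroup X] [NormedSpace ℝ X] [CompleteSpace X]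
    (S : ℝ → X →L[ℝ] X)
    (hScont : ∀ x : X, ContinuousOn (fun σ => S σ x) (Set.Ici (0 : ℝ))) (T : ℝ) :
    ∃ C : ℝ, 0 ≤ C ∧ ∀ σ ∈ Set.Icc (0:ℝ) T, ‖S σ‖ ≤ C := by
  have h : ∃ C', ∀ i : Set.Icc (0:ℝ) T, ‖S i‖ ≤ C' := by
    apply banach_steinhaus
    intro x
    obtain ⟨C, hC⟩ := (isCompact_Icc (a := (0:ℝ)) (b := T)).exists_bound_of_continuousOn
      ((hScont x).mono Set.Icc_subset_Ici_self)
    exact ⟨C, fun i => hC i i.2⟩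
  obtain ⟨C, hC⟩ := h
  exact ⟨max C 0, le_max_right _ _, fun σ hσ => (hC ⟨σ, hσ⟩).trans (le_max_left _ _)⟩

lemma aux_joint {X : Type*} [NormedAddCommGroup X] [NormedSpace ℝ X] [CompleteSpace X]
    (S : ℝ → X →L[ℝ] X)
    (hScont : ∀ x : X, ContinuousOn (fun σ => S σ x) (Set.Ici (0 : ℝ))) :
    Continuous (fun p : ℝ × X => S (max p.1 0) p.2) := by
  have hc : ∀ x, Continuous (fun σ : ℝ => S (max σ 0) x) := fun x =>
    (hScont x).comp_continuous (by fun_prop) (fun σ => Set.mem_Ici.2 (le_max_right _ _))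
  rw [continuous_iff_continuousAt]
  rintro ⟨σ0, y⟩
  obtain ⟨C, hC0, hC⟩ := aux_bound S hScont (max (σ0 + 1) 0)
  rw [ContinuousAt, tendsto_iff_norm_sub_tendsto_zero]
  have h1 : Tendsto (fun p : ℝ × X => C * ‖p.2 - y‖ + ‖S (max p.1 0) y - S (max σ0 0) y‖)
      (nhds (σ0, y)) (nhds 0) := by
    have : Continuous (fun p : ℝ × X => C * ‖p.2 - y‖ + ‖S (max p.1 0) y - S (max σ0 0) y‖) := by
      have h3 : Continuous (fun p : ℝ × X => S (max p.1 0) y) :=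
        (hc y).comp (continuous_fst (X := ℝ) (Y := X))
      exact (continuous_const.mul (continuous_snd.sub continuous_const).norm).add
        (h3.sub continuous_const).norm
    have h2 := this.tendsto (σ0, y)
    simpa using h2
  refine squeeze_zero' (Eventually.of_forall fun _ => norm_nonneg _) ?_ h1
  have hev : ∀ᶠ p : ℝ × X in nhds (σ0, y), p.1 < σ0 + 1 :=
    (continuous_fst.tendsto (σ0, y)).eventually (gt_mem_nhds (by simp))
  filter_upwards [hev] with p hp
  have e : S (max p.1 0) p.2 - S (max σ0 0) y
      = S (max p.1 0) (p.2 - y) + (S (max p.1 0) y - S (max σ0 0) y) := by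
    rw [map_sub]; abel
  rw [e]
  refine (norm_add_le _ _).trans (add_le_add ?_ le_rfl)
  refine ((S _).le_opNorm _).trans (mul_le_mul_of_nonneg_right (hC _ ⟨le_max_right _ _, ?_⟩)
    (norm_nonneg _))
  exact max_le_max hp.le le_rfl

lemma aux_carath {α X Y : Type*} [MeasurableSpace α] [NormedAddCommGroup X]
    [NormedAddCommGroup Y]
    {μ : Measure α} (F : α → X → Y) (hF : ∀ x, AEStronglyMeasurable (fun t => F t x) μ)
    (M : ℝ) (hL : ∀ᵐ t ∂μ, ∀ x y, ‖F t x - F t y‖ ≤ M * ‖x - y‖)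
    (φ : α → X) (hφ : AEStronglyMeasurable φ μ) :
    AEStronglyMeasurable (fun t => F t (φ t)) μ := by
  obtain ⟨ψ, hψ, hae⟩ := hφ
  have hs : ∀ s : SimpleFunc α X, AEStronglyMeasurable (fun t => F t (s t)) μ := by
    intro s
    have : (fun t => F t (s t)) =
        fun t => ∑ y ∈ s.range, (s ⁻¹' {y}).indicator (fun t => F t y) t := by
      funext t
      rw [Finset.sum_eq_single (s t)]
      · simp
      · intro b _ hb
        simp [Set.indicator, hb.symm]
      · intro h; exact absurd (SimpleFunc.mem_range_self s t) h
    rw [this]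
    refine Finset.aestronglyMeasurable_fun_sum _ fun y _ => ?_
    exact (hF y).indicator (s.measurableSet_fiber y)
  refine aestronglyMeasurable_of_tendsto_ae (u := atTop)
    (f := fun n t => F t (hψ.approx n t)) (fun n => hs _) ?_
  filter_upwards [hL, hae] with t ht he
  rw [he, tendsto_iff_norm_sub_tendsto_zero]
  refine squeeze_zero (fun _ => norm_nonneg _) (fun n => ht _ _) ?_
  have := tendsto_iff_norm_sub_tendsto_zero.1 (hψ.tendsto_approx t)
  simpa using this.const_mul M

lemma aux_gronwall_s7 {T ε L : ℝ} (hT : 0 ≤ T) (hε : 0 ≤ ε) (hL : 0 ≤ L) (d : ℝ → ℝ)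
    (hd : ContinuousOn d (Set.Icc 0 T))
    (h : ∀ t ∈ Set.Icc 0 T, d t ≤ ε + L * ∫ τ in (0:ℝ)..t, d τ) :
    ∀ t ∈ Set.Icc 0 T, d t ≤ ε * Real.exp (L * T) := by
  set D : ℝ → ℝ := fun τ => d (max 0 (min T τ)) with hD
  have hDc : Continuous D := hd.comp_continuous (by fun_prop)
    (fun τ => ⟨le_max_left _ _, max_le hT (min_le_left _ _)⟩)
  have hDd : ∀ t ∈ Set.Icc 0 T, D t = d t := by
    rintro t ⟨h0, h1⟩
    simp [hD, h0, h1]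
  have hint : ∀ t ∈ Set.Icc 0 T, ∫ τ in (0:ℝ)..t, D τ = ∫ τ in (0:ℝ)..t, d τ := by
    rintro t ⟨h0, h1⟩
    refine intervalIntegral.integral_congr fun τ hτ => ?_
    rw [Set.uIcc_of_le h0] at hτ
    exact hDd τ ⟨hτ.1, hτ.2.trans h1⟩
  set H : ℝ → ℝ := fun t => Real.exp (-(L * t)) * (ε + L * ∫ τ in (0:ℝ)..t, D τ) with hH
  have hder : ∀ t, HasDerivAt H
      (Real.exp (-(L * t)) * (-(L * 1)) * (ε + L * ∫ τ in (0:ℝ)..t, D τ)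
        + Real.exp (-(L * t)) * (L * D t)) t := by
    intro t
    have h1 : HasDerivAt (fun t => Real.exp (-(L * t))) (Real.exp (-(L * t)) * (-(L * 1))) t :=
      (((hasDerivAt_id t).const_mul L).neg).exp
    have h2 : HasDerivAt (fun t => ∫ τ in (0:ℝ)..t, D τ) (D t) t :=
      hDc.integral_hasStrictDerivAt 0 t |>.hasDerivAt
    exact h1.mul ((h2.const_mul L).const_add ε)
  have hanti : AntitoneOn H (Set.Icc 0 T) := by
    refine antitoneOn_of_deriv_nonpos (convex_Icc 0 T)
      (fun t _ => (hder t).continuousAt.continuousWithinAt)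
      (fun t _ => (hder t).differentiableAt.differentiableWithinAt) ?_
    intro t ht
    have ht' := interior_subset ht
    rw [(hder t).deriv]
    have := h t ht'
    rw [← hDd t ht', ← hint t ht'] at this
    have e := Real.exp_pos (-(L * t))
    nlinarith [mul_nonneg (mul_nonneg e.le hL) (sub_nonneg.2 this)]
  intro t ht
  have h1 := hanti (Set.left_mem_Icc.2 hT) ht ht.1
  simp only [hH, mul_zero, neg_zero, Real.exp_zero, intervalIntegral.integral_same, add_zero,
    one_mul, hint t ht] at h1
  refine (h t ht).trans ?_
  rw [Real.exp_neg, inv_mul_le_iff₀ (Real.exp_pos _)] at h1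
  refine h1.trans ?_
  rw [mul_comm]
  gcongr
  exact ht.2

/-- Pointwise convergence against Bochner integrable functions. -/
lemma aux_pointwise {α X : Type*} [MeasurableSpace α] [NormedAddCommGroup X] [NormedSpace ℝ X]
    [CompleteSpace X]
    {μ : Measure α} [IsFiniteMeasure μ] (a : ℕ → α → ℝ) (A : ℝ)
    (ham : ∀ n, AEStronglyMeasurable (a n) μ) (hab : ∀ n, ∀ᵐ t ∂μ, ‖a n t‖ ≤ A)
    (hw : ∀ s, MeasurableSet s → Tendsto (fun n => ∫ t in s, a n t ∂μ) atTop (nhds 0))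
    (K : α → X) (hK : Integrable K μ) :
    Tendsto (fun n => ∫ t, a n t • K t ∂μ) atTop (nhds 0) := by
  have hi : ∀ (n : ℕ) (K : α → X), Integrable K μ → Integrable (fun t => a n t • K t) μ :=
    fun n K hK => hK.bdd_smul A (ham n) (hab n)
  refine Integrable.induction
    (fun K => Tendsto (fun n => ∫ t, a n t • K t ∂μ) atTop (nhds 0)) ?_ ?_ ?_ ?_ hK
  · intro c s hs _
    have : ∀ n, ∫ t, a n t • s.indicator (fun _ => c) t ∂μ = (∫ t in s, a n t ∂μ) • c := by
      intro n
      rw [← integral_smul_const, ← integral_indicator hs]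
      congr 1; funext t
      by_cases h : t ∈ s <;> simp [h]
    simp only [this]
    simpa using (hw s hs).smul_const c
  · intro f g _ hf hg hPf hPg
    have := hPf.add hPg
    simp only [add_zero] at this
    refine this.congr fun n => ?_
    rw [← integral_add (hi n f hf) (hi n g hg)]
    simp
  · rw [← isSeqClosed_iff_isClosed]
    intro Fk F hFk hF
    simp only [Set.mem_ofPred_eq] at hFk ⊢
    rw [Metric.tendsto_atTop]
    intro ε hε
    have hF' := (tendsto_iff_norm_sub_tendsto_zero.1 hF).const_mul (|A|)
    rw [mul_zero] at hF'
    obtain ⟨k, hk⟩ := (hF'.eventually (gt_mem_nhds (half_pos hε))).exists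
    obtain ⟨N, hN⟩ := Metric.tendsto_atTop.1 (hFk k) (ε / 2) (half_pos hε)
    refine ⟨N, fun n hn => ?_⟩
    have h1 := hN n hn
    rw [dist_zero_right] at h1 ⊢
    have e : ∫ t, a n t • F t ∂μ = ∫ t, a n t • Fk k t ∂μ - ∫ t, a n t • ((Fk k : α → X) t - F t) ∂μ := by
      simp only [smul_sub]
      rw [integral_sub (hi n _ (L1.integrable_coeFn _)) (hi n _ (L1.integrable_coeFn _))]
      abel
    have h2 : ‖∫ t, a n t • ((Fk k : α → X) t - F t) ∂μ‖ ≤ |A| * ‖Fk k - F‖ := by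
      rw [L1.norm_eq_integral_norm, ← integral_const_mul]
      refine norm_integral_le_of_norm_le ((L1.integrable_coeFn _).norm.const_mul _) ?_
      filter_upwards [hab n, Lp.coeFn_sub (Fk k) F] with t ht h3
      rw [norm_smul, h3, Pi.sub_apply]
      exact mul_le_mul_of_nonneg_right (ht.trans (le_abs_self A)) (norm_nonneg _)
    rw [e]
    calc _ ≤ _ := norm_sub_le _ _
      _ < ε / 2 + ε / 2 := add_lt_add h1 (h2.trans_lt hk)
      _ = ε := by ring
  · intro f g hfg _ hP
    refine hP.congr fun n => integral_congr_ae ?_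
    filter_upwards [hfg] with t ht
    rw [ht]

lemma aux_unif {X : Type*} [NormedAddCommGroup X] [NormedSpace ℝ X] [CompleteSpace X]
    {T : ℝ} (a : ℕ → ℝ → ℝ) (A : ℝ)
    (ham : ∀ n, AEStronglyMeasurable (a n) (volume.restrict (Set.Icc (0:ℝ) T)))
    (hab : ∀ n, ∀ᵐ t ∂(volume.restrict (Set.Icc (0:ℝ) T)), ‖a n t‖ ≤ A)
    (hw : ∀ s, MeasurableSet s →
      Tendsto (fun n => ∫ t in s, a n t ∂(volume.restrict (Set.Icc (0:ℝ) T))) atTop (nhds 0))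
    (k : ℝ → X) (hk : Continuous k) :
    TendstoUniformlyOn (fun n t => ∫ τ in (0:ℝ)..t, a n τ • k (t - τ)) (fun _ => 0) atTop
      (Set.Icc (0:ℝ) T) := by
  set μ := volume.restrict (Set.Icc (0:ℝ) T) with hμ
  set K : ℝ → ℝ → X := fun t => (Set.Iic t).indicator (fun τ => k (t - τ)) with hKdef
  obtain ⟨B, hB⟩ := (isCompact_Icc (a := -T) (b := T)).exists_bound_of_continuousOn hk.continuousOn
  have hKm : ∀ t, AEStronglyMeasurable (K t) μ := fun t =>
    ((by fun_prop : Continuous fun τ => k (t - τ)).aestronglyMeasurable).indicator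
      measurableSet_Iic
  have hmem : ∀ᵐ τ ∂μ, τ ∈ Set.Icc (0:ℝ) T := ae_restrict_mem measurableSet_Icc
  have hKb : ∀ t ∈ Set.Icc (0:ℝ) T, ∀ᵐ τ ∂μ, ‖K t τ‖ ≤ |B| := by
    intro t ht
    filter_upwards [hmem] with τ hτ
    refine (norm_indicator_le_norm_self _ _).trans ((hB _ ?_).trans (le_abs_self B))
    constructor <;> linarith [ht.1, ht.2, hτ.1, hτ.2]
  have hKi : ∀ t ∈ Set.Icc (0:ℝ) T, Integrable (K t) μ := fun t ht =>
    Integrable.of_bound (hKm t) _ (hKb t ht)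
  have he : ∀ n, ∀ t ∈ Set.Icc (0:ℝ) T,
      ∫ τ in (0:ℝ)..t, a n τ • k (t - τ) = ∫ τ, a n τ • K t τ ∂μ := by
    intro n t ht
    rw [intervalIntegral.integral_of_le ht.1, ← integral_Icc_eq_integral_Ioc]
    have h1 : (fun τ => a n τ • K t τ) = (Set.Iic t).indicator (fun τ => a n τ • k (t - τ)) := by
      funext τ
      by_cases h : τ ∈ Set.Iic t <;> simp [hKdef, h]
    rw [h1, integral_indicator measurableSet_Iic, hμ, Measure.restrict_restrict measurableSet_Iic]
    congr 2
    ext τ; simp only [Set.mem_Icc, Set.mem_inter_iff, Set.mem_Iic]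
    constructor
    · rintro ⟨h0, h1⟩; exact ⟨h1, h0, h1.trans ht.2⟩
    · rintro ⟨h0, h1, _⟩; exact ⟨h1, h0⟩
  rw [← tendstoLocallyUniformlyOn_iff_tendstoUniformlyOn_of_compact isCompact_Icc,
    Metric.tendstoLocallyUniformlyOn_iff]
  intro ε hε s hs
  -- continuity of `t ↦ K t` in `L¹`
  have hω : Tendsto (fun t => A * ∫ τ, ‖K t τ - K s τ‖ ∂μ) (nhdsWithin s (Set.Icc 0 T))
      (nhds 0) := by
    have : Tendsto (fun t => ∫ τ, ‖K t τ - K s τ‖ ∂μ) (nhdsWithin s (Set.Icc 0 T))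
        (nhds (∫ τ, (0:ℝ) ∂μ)) := by
      refine tendsto_integral_filter_of_dominated_convergence (fun _ => |B| + |B|) ?_ ?_
        (integrable_const _) ?_
      · exact Eventually.of_forall fun t => ((hKm t).sub (hKm s)).norm
      · filter_upwards [self_mem_nhdsWithin] with t ht
        filter_upwards [hKb t ht, hKb s hs] with τ h1 h2
        rw [norm_norm]
        exact (norm_sub_le _ _).trans (add_le_add h1 h2)
      · have hne : ∀ᵐ τ ∂μ, τ ≠ s := by
          refine ae_restrict_of_ae ?_
          exact Measure.ae_ne volume s
        filter_upwards [hne] with τ hτ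
        refine Tendsto.mono_left ?_ nhdsWithin_le_nhds
        rw [← tendsto_iff_norm_sub_tendsto_zero]
        have hc : Tendsto (fun t => k (t - τ)) (nhds s) (nhds (k (s - τ))) :=
          (by fun_prop : Continuous fun t => k (t - τ)).tendsto s
        rcases lt_or_gt_of_ne hτ with h | h
        · have : K s τ = k (s - τ) := by simp [hKdef, h.le]
          rw [this]
          refine hc.congr' ?_
          filter_upwards [lt_mem_nhds h] with t ht
          simp [hKdef, ht.le]
        · have : K s τ = 0 := by simp [hKdef, h]
          rw [this]
          refine tendsto_const_nhds.congr' ?_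
          filter_upwards [gt_mem_nhds h] with t ht
          simp [hKdef, ht]
    simpa using this.const_mul A
  refine ⟨_, inter_mem self_mem_nhdsWithin (hω.eventually (gt_mem_nhds (half_pos hε))), ?_⟩
  have hp := aux_pointwise a A ham hab hw (K s) (hKi s hs)
  filter_upwards [(Metric.tendsto_nhds.1 hp) (ε / 2) (half_pos hε)] with n hn
  rintro t ⟨ht, hlt⟩
  rw [dist_zero_left, he n t ht]
  rw [dist_zero_right] at hn
  have hi : ∀ t ∈ Set.Icc (0:ℝ) T, Integrable (fun τ => a n τ • K t τ) μ := fun t ht =>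
    (hKi t ht).bdd_smul A (ham n) (hab n)
  have e : ∫ τ, a n τ • K t τ ∂μ
      = ∫ τ, a n τ • (K t τ - K s τ) ∂μ + ∫ τ, a n τ • K s τ ∂μ := by
    simp only [smul_sub]
    rw [integral_sub (hi t ht) (hi s hs)]; abel
  have h2 : ‖∫ τ, a n τ • (K t τ - K s τ) ∂μ‖ ≤ A * ∫ τ, ‖K t τ - K s τ‖ ∂μ := by
    rw [← integral_const_mul]
    refine norm_integral_le_of_norm_le (((hKi t ht).sub (hKi s hs)).norm.const_mul _) ?_
    filter_upwards [hab n] with τ h3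
    rw [norm_smul]
    exact mul_le_mul_of_nonneg_right h3 (norm_nonneg _)
  rw [e]
  calc _ ≤ _ := norm_add_le _ _
    _ < ε / 2 + ε / 2 := add_lt_add (h2.trans_lt hlt) hn
    _ = ε := by ring

/-- under (A) and the finite-channel structure (C), weak* convergence
`uⁿ → u` in `σ(L^∞, L^1)` implies uniform convergence of the trajectories
`x^{uⁿ} → x^u` in `C(I;X)`. -/
theorem trajectories_converge_of_weakStar_convergence
    {X : Type*} [NormedAddCommGroup X] [NormedSpace ℝ X] [CompleteSpace X]
    {m : ℕ} {T : ℝ} (hT : 0 < T)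
    (S : ℝ → X →L[ℝ] X)
    (hS0 : S 0 = ContinuousLinearMap.id ℝ X)
    (hSadd : ∀ a b : ℝ, 0 ≤ a → 0 ≤ b → S (a + b) = (S a).comp (S b))
    (hScont : ∀ x : X, ContinuousOn (fun σ => S σ x) (Set.Ici (0 : ℝ)))
    (U : Set (EuclideanSpace ℝ (Fin m))) (hUcpt : IsCompact U) (hUcvx : Convex ℝ U)
    (f : ℝ → X → X) (G : ℝ → X → EuclideanSpace ℝ (Fin m) →L[ℝ] X)
    {Mf MG : ℝ} (hMf : 0 ≤ Mf) (hMG : 0 ≤ MG)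
    (hfmeas : ∀ x : X,
      AEStronglyMeasurable (fun t => f t x) (volume.restrict (Set.Icc (0:ℝ) T)))
    (hGmeas : ∀ x : X,
      AEStronglyMeasurable (fun t => G t x) (volume.restrict (Set.Icc (0:ℝ) T)))
    (hA : ∀ᵐ t ∂(volume.restrict (Set.Icc (0:ℝ) T)),
        (∀ x y : X, ‖f t x - f t y‖ ≤ Mf * ‖x - y‖) ∧
        (∀ x y : X, ‖G t x - G t y‖ ≤ MG * ‖x - y‖) ∧
        ‖f t 0‖ ≤ Mf ∧ ‖G t 0‖ ≤ MG)
    (g : Fin m → ℝ → X → EuclideanSpace ℝ (Fin m)) (hvec : Fin m → X)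
    (hGstruct : ∀ t : ℝ, ∀ x : X, ∀ v : EuclideanSpace ℝ (Fin m),
        G t x v = ∑ j : Fin m, ⟪v, g j t x⟫ • hvec j)
    (hgmeas : ∀ j : Fin m, ∀ x : X,
      AEStronglyMeasurable (fun t => g j t x) (volume.restrict (Set.Icc (0:ℝ) T)))
    (hgA : ∀ᵐ t ∂(volume.restrict (Set.Icc (0:ℝ) T)), ∀ j : Fin m,
        (∀ x y : X, ‖g j t x - g j t y‖ ≤ MG * ‖x - y‖) ∧ ‖g j t 0‖ ≤ MG)
    (x₀ : X)
    (un : ℕ → ℝ → EuclideanSpace ℝ (Fin m)) (u : ℝ → EuclideanSpace ℝ (Fin m))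
    (hun : ∀ n, Admissible T U (un n)) (hu : Admissible T U u)
    (hconv : ∀ φ : ℝ → EuclideanSpace ℝ (Fin m), IntegrableOn φ (Set.Icc (0:ℝ) T) →
      Tendsto (fun n => ∫ t in Set.Icc (0:ℝ) T, ⟪un n t, φ t⟫) atTop
        (nhds (∫ t in Set.Icc (0:ℝ) T, ⟪u t, φ t⟫)))
    (xn : ℕ → ℝ → X) (xu : ℝ → X)
    (hxn : ∀ n, IsMildSol T S (fun τ y => f τ y + G τ y (un n τ)) 0 x₀ (xn n))
    (hxu : IsMildSol T S (fun τ y => f τ y + G τ y (u τ)) 0 x₀ xu) :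
    TendstoUniformlyOn (fun n t => xn n t) xu atTop (Set.Icc (0:ℝ) T) := by
  set μ := volume.restrict (Set.Icc (0:ℝ) T) with hμ
  obtain ⟨C, hC0, hC⟩ := aux_bound S hScont T
  have hJ := aux_joint S hScont
  have hbU : ∃ R : ℝ, 0 ≤ R ∧ ∀ v ∈ U, ‖v‖ ≤ R := by
    obtain ⟨R, hR⟩ := hUcpt.isBounded.exists_norm_le
    exact ⟨max R 0, le_max_right _ _, fun v hv => (hR v hv).trans (le_max_left _ _)⟩
  obtain ⟨R, hR0, hR⟩ := hbU
  have hmem : ∀ᵐ τ ∂μ, τ ∈ Set.Icc (0:ℝ) T := ae_restrict_mem measurableSet_Icc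
  -- integrability helper
  have hSi : ∀ w : ℝ → X, AEStronglyMeasurable w μ → (∃ B, ∀ᵐ τ ∂μ, ‖w τ‖ ≤ B) →
      ∀ t ∈ Set.Icc (0:ℝ) T, IntervalIntegrable (fun τ => S (t - τ) (w τ)) volume 0 t := by
    rintro w hw ⟨B, hB⟩ t ht
    rw [intervalIntegrable_iff_integrableOn_Icc_of_le ht.1]
    have hle : volume.restrict (Set.Icc 0 t) ≤ μ :=
      Measure.restrict_mono (Set.Icc_subset_Icc_right ht.2) le_rfl
    have hmem' : ∀ᵐ τ ∂(volume.restrict (Set.Icc 0 t)), τ ∈ Set.Icc (0:ℝ) t :=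
      ae_restrict_mem measurableSet_Icc
    have hm : AEStronglyMeasurable (fun τ => S (max (t - τ) 0) (w τ))
        (volume.restrict (Set.Icc 0 t)) :=
      hJ.comp_aestronglyMeasurable (f := fun τ => (t - τ, w τ))
        (AEStronglyMeasurable.prodMk (by fun_prop : Continuous fun τ => t - τ).aestronglyMeasurable
          (hw.mono_measure hle))
    refine Integrable.of_bound (C := C * B) (hm.congr ?_) ?_
    · filter_upwards [hmem'] with τ hτ
      rw [max_eq_left (sub_nonneg.2 hτ.2)]
    · filter_upwards [hmem', ae_mono hle hB] with τ hτ h1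
      exact (S _).le_of_opNorm_le_of_le
        (hC _ ⟨sub_nonneg.2 hτ.2, by linarith [hτ.1, ht.2]⟩) h1
  -- growth
  have hgrow : ∀ (x : ℝ → X) (v : ℝ → EuclideanSpace ℝ (Fin m)),
      ContinuousOn x (Set.Icc 0 T) → Admissible T U v →
      AEStronglyMeasurable (fun τ => f τ (x τ) + G τ (x τ) (v τ)) μ ∧
      ∃ B, ∀ᵐ τ ∂μ, ‖f τ (x τ) + G τ (x τ) (v τ)‖ ≤ B := by
    intro x v hx hv
    have hxm : AEStronglyMeasurable x μ := hx.aestronglyMeasurable measurableSet_Icc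
    obtain ⟨B, hB⟩ := isCompact_Icc.exists_bound_of_continuousOn hx
    have hfm := aux_carath f hfmeas Mf (hA.mono fun t h => h.1) x hxm
    have hGm := aux_carath G hGmeas MG (hA.mono fun t h => h.2.1) x hxm
    refine ⟨hfm.add ?_, (Mf + Mf * B) + (MG + MG * B) * R, ?_⟩
    · exact (isBoundedBilinearMap_apply (𝕜 := ℝ)).continuous.comp_aestronglyMeasurable
        (hGm.prodMk hv.1)
    · filter_upwards [hA, hmem, hv.2] with τ h hτ hvτ
      obtain ⟨h1, h2, h3, h4⟩ := h
      have hb := hB τ hτ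
      have e1 : ‖f τ (x τ)‖ ≤ Mf + Mf * B := by
        have := h1 (x τ) 0
        rw [sub_zero] at this
        calc ‖f τ (x τ)‖ = ‖f τ 0 + (f τ (x τ) - f τ 0)‖ := by congr 1; abel
          _ ≤ _ := norm_add_le _ _
          _ ≤ Mf + Mf * B := add_le_add h3 (this.trans (by gcongr))
      have e2 : ‖G τ (x τ)‖ ≤ MG + MG * B := by
        have := h2 (x τ) 0
        rw [sub_zero] at this
        calc ‖G τ (x τ)‖ = ‖G τ 0 + (G τ (x τ) - G τ 0)‖ := by congr 1; abel
          _ ≤ _ := norm_add_le _ _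
          _ ≤ MG + MG * B := add_le_add h4 (this.trans (by gcongr))
      exact (norm_add_le _ _).trans (add_le_add e1
        ((G τ (x τ)).le_of_opNorm_le_of_le e2 (hR _ hvτ)))
  -- the scalar channels along the limit trajectory
  have hxum : AEStronglyMeasurable xu μ := hxu.1.aestronglyMeasurable measurableSet_Icc
  have hgm : ∀ j, AEStronglyMeasurable (fun τ => g j τ (xu τ)) μ := fun j =>
    aux_carath (g j) (hgmeas j) MG (hgA.mono fun t h => (h j).1) xu hxum
  obtain ⟨B, hB⟩ := isCompact_Icc.exists_bound_of_continuousOn hxu.1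
  have hgb : ∀ j, ∀ᵐ τ ∂μ, ‖g j τ (xu τ)‖ ≤ MG + MG * B := by
    intro j
    filter_upwards [hgA, hmem] with τ h hτ
    have h2 := (h j).1 (xu τ) 0
    have hb := hB τ hτ
    rw [sub_zero] at h2
    calc ‖g j τ (xu τ)‖ = ‖g j τ 0 + (g j τ (xu τ) - g j τ 0)‖ := by congr 1; abel
      _ ≤ _ := norm_add_le _ _
      _ ≤ MG + MG * B := add_le_add (h j).2 (h2.trans (by gcongr))
  have hgi : ∀ j, Integrable (fun τ => g j τ (xu τ)) μ := fun j =>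
    Integrable.of_bound (hgm j) _ (hgb j)
  set a : Fin m → ℕ → ℝ → ℝ := fun j n τ => ⟪un n τ - u τ, g j τ (xu τ)⟫ with ha
  have ham : ∀ j n, AEStronglyMeasurable (a j n) μ := fun j n =>
    ((hun n).1.sub hu.1).inner (hgm j)
  have hab : ∀ j n, ∀ᵐ τ ∂μ, ‖a j n τ‖ ≤ (R + R) * (MG + MG * B) := by
    intro j n
    filter_upwards [(hun n).2, hu.2, hgb j] with τ h1 h2 h3
    refine (norm_inner_le_norm _ _).trans ?_
    have h4 : ‖un n τ - u τ‖ ≤ R + R := (norm_sub_le _ _).trans (add_le_add (hR _ h1) (hR _ h2))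
    exact mul_le_mul h4 h3 (norm_nonneg _) (by positivity)
  have hinn : ∀ (v : ℝ → EuclideanSpace ℝ (Fin m)), Admissible T U v →
      ∀ φ : ℝ → EuclideanSpace ℝ (Fin m), Integrable φ μ →
      Integrable (fun τ => ⟪v τ, φ τ⟫) μ := by
    intro v hv φ hφ
    refine (hφ.norm.const_mul R).mono' (hv.1.inner hφ.1) ?_
    filter_upwards [hv.2] with τ h
    exact (norm_inner_le_norm _ _).trans (mul_le_mul_of_nonneg_right (hR _ h) (norm_nonneg _))
  have hw : ∀ j s, MeasurableSet s →
      Tendsto (fun n => ∫ t in s, a j n t ∂μ) atTop (nhds 0) := by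
    intro j s hs
    have hφ : Integrable (s.indicator fun τ => g j τ (xu τ)) μ := (hgi j).indicator hs
    have h1 := (hconv _ hφ).sub_const (∫ t, ⟪u t, s.indicator (fun τ => g j τ (xu τ)) t⟫ ∂μ)
    rw [sub_self] at h1
    refine h1.congr fun n => ?_
    rw [← integral_sub (hinn _ (hun n) _ hφ) (hinn _ hu _ hφ), ← integral_indicator hs]
    congr 1; funext t
    by_cases h : t ∈ s <;> simp [h, ha, inner_sub_left]
  have hunif : ∀ j, TendstoUniformlyOn
      (fun n t => ∫ τ in (0:ℝ)..t, a j n τ • S (max (t - τ) 0) (hvec j)) (fun _ => 0) atTop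
      (Set.Icc (0:ℝ) T) := fun j =>
    aux_unif (a j) _ (ham j) (hab j) (hw j) (fun σ => S (max σ 0) (hvec j))
      (hJ.comp (by fun_prop : Continuous fun σ : ℝ => (σ, hvec j)))
  -- conclusion
  set L := C * (Mf + MG * R) with hLdef
  have hL0 : 0 ≤ L := by positivity
  rw [Metric.tendstoUniformlyOn_iff]
  intro ε hε
  have hδ : ∃ δ : ℝ, 0 < δ ∧ (m * δ) * Real.exp (L * T) < ε := by
    refine ⟨ε / ((m + 1) * Real.exp (L * T)), by positivity, ?_⟩
    have hE := Real.exp_pos (L * T)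
    rw [show (m * (ε / ((m + 1) * Real.exp (L * T)))) * Real.exp (L * T)
      = ε * (m / (m + 1)) by field_simp]
    have : (m : ℝ) / (m + 1) < 1 := by rw [div_lt_one (by positivity)]; linarith
    nlinarith
  obtain ⟨δ, hδ0, hδ⟩ := hδ
  have hev : ∀ᶠ n in atTop, ∀ j, ∀ t ∈ Set.Icc (0:ℝ) T,
      dist 0 (∫ τ in (0:ℝ)..t, a j n τ • S (max (t - τ) 0) (hvec j)) < δ :=
    eventually_all.2 fun j => (Metric.tendstoUniformlyOn_iff.1 (hunif j)) δ hδ0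
  filter_upwards [hev] with n hn
  have hdc : ContinuousOn (fun t => ‖xn n t - xu t‖) (Set.Icc 0 T) :=
    ((hxn n).1.sub hxu.1).norm
  have key : ∀ t ∈ Set.Icc (0:ℝ) T,
      ‖xn n t - xu t‖ ≤ m * δ + L * ∫ τ in (0:ℝ)..t, ‖xn n τ - xu τ‖ := by
    intro t ht
    obtain ⟨p1, p2⟩ := hgrow (xn n) (un n) (hxn n).1 (hun n)
    obtain ⟨q1, q2⟩ := hgrow xu u hxu.1 hu
    have hP := hSi _ p1 p2 t ht
    have hQ := hSi _ q1 q2 t ht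
    have hEj : ∀ j, IntervalIntegrable (fun τ => S (t - τ) (a j n τ • hvec j)) volume 0 t := by
      intro j
      refine hSi (fun τ => a j n τ • hvec j) ((ham j n).smul_const _)
        ⟨(R + R) * (MG + MG * B) * ‖hvec j‖, ?_⟩ t ht
      filter_upwards [hab j n] with τ h
      rw [norm_smul]
      exact mul_le_mul_of_nonneg_right h (norm_nonneg _)
    have hE : IntervalIntegrable (fun τ => ∑ j, S (t - τ) (a j n τ • hvec j)) volume 0 t := by
      have := IntervalIntegrable.sum Finset.univ (fun j _ => hEj j)
      have e0 : (fun τ => ∑ j, S (t - τ) (a j n τ • hvec j))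
          = ∑ j, fun τ => S (t - τ) (a j n τ • hvec j) := by
        funext τ; simp
      rw [e0]
      exact this
    have hEb : ‖∫ τ in (0:ℝ)..t, ∑ j, S (t - τ) (a j n τ • hvec j)‖ ≤ m * δ := by
      rw [intervalIntegral.integral_finsetSum (fun j _ => hEj j)]
      refine (norm_sum_le _ _).trans ?_
      calc _ ≤ ∑ _j : Fin m, δ := by
            refine Finset.sum_le_sum fun j _ => ?_
            have h1 := (hn j t ht).le
            rw [dist_zero_left] at h1
            refine le_of_eq_of_le (congrArg norm ?_) h1
            refine intervalIntegral.integral_congr fun τ hτ => ?_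
            rw [Set.uIcc_of_le ht.1] at hτ
            rw [max_eq_left (sub_nonneg.2 hτ.2), map_smul]
        _ = m * δ := by simp
    have hdiff : xn n t - xu t =
        (∫ τ in (0:ℝ)..t, (S (t - τ) (f τ (xn n τ) + G τ (xn n τ) (un n τ))
          - S (t - τ) (f τ (xu τ) + G τ (xu τ) (u τ))
          - ∑ j, S (t - τ) (a j n τ • hvec j)))
        + ∫ τ in (0:ℝ)..t, ∑ j, S (t - τ) (a j n τ • hvec j) := by
      rw [intervalIntegral.integral_sub (hP.sub hQ) hE, intervalIntegral.integral_sub hP hQ,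
        (hxn n).2 t ht, hxu.2 t ht]
      abel
    rw [hdiff, add_comm]
    refine (norm_add_le _ _).trans (add_le_add hEb ?_)
    rw [← intervalIntegral.integral_const_mul]
    have hdi : IntervalIntegrable (fun τ => L * ‖xn n τ - xu τ‖) volume 0 t := by
      refine ContinuousOn.intervalIntegrable ?_
      rw [Set.uIcc_of_le ht.1]
      exact continuousOn_const.mul (hdc.mono (Set.Icc_subset_Icc_right ht.2))
    refine intervalIntegral.norm_integral_le_of_norm_le ht.1 ?_ hdi
    have h1 := (ae_restrict_iff' measurableSet_Icc).1 hA
    have h2 := (ae_restrict_iff' measurableSet_Icc).1 (hun n).2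
    filter_upwards [h1, h2] with τ h1 h2 hτ
    have hτ' : τ ∈ Set.Icc 0 T := ⟨hτ.1.le, hτ.2.trans ht.2⟩
    obtain ⟨hf, hG, -, -⟩ := h1 hτ'
    have hv := hR _ (h2 hτ')
    have e : S (t - τ) (f τ (xn n τ) + G τ (xn n τ) (un n τ))
          - S (t - τ) (f τ (xu τ) + G τ (xu τ) (u τ))
          - ∑ j, S (t - τ) (a j n τ • hvec j)
        = S (t - τ) ((f τ (xn n τ) - f τ (xu τ)) + (G τ (xn n τ) - G τ (xu τ)) (un n τ)) := by
      have e1 : ∑ j, a j n τ • hvec j = G τ (xu τ) (un n τ) - G τ (xu τ) (u τ) := by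
        rw [← map_sub, hGstruct]
      rw [← map_sum, e1, ← map_sub, ← map_sub]
      congr 1
      rw [sub_apply]
      abel
    rw [e]
    have hin : ‖(f τ (xn n τ) - f τ (xu τ)) + (G τ (xn n τ) - G τ (xu τ)) (un n τ)‖
        ≤ Mf * ‖xn n τ - xu τ‖ + MG * ‖xn n τ - xu τ‖ * R :=
      (norm_add_le _ _).trans (add_le_add (hf _ _)
        ((G τ (xn n τ) - G τ (xu τ)).le_of_opNorm_le_of_le (hG _ _) hv))
    refine ((S _).le_of_opNorm_le_of_le
        (hC _ ⟨sub_nonneg.2 hτ.2, by linarith [hτ.1, ht.2]⟩) hin).trans (le_of_eq ?_)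
    rw [hLdef]; ring
  intro t ht
  rw [dist_eq_norm, norm_sub_rev]
  exact (aux_gronwall_s7 hT.le (by positivity) hL0 _ hdc key t ht).trans_lt hδ
end
end
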